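/- Let i be an even positive integer, let n = 3i + 1 or n = 3i − 1, q = 2^n, and s = 2^{2i} − 2^i + 1. Let d be the multiplicative inverse of s modulo 2^n − 1, and let B_s = {(x+1)^s + x^s : x ∈ GF(q)}. Then the incidence structure (GF(q), GA₁(q)(B_s)) is a 3-(q, q/2, q(q−4)/8) design if and only if the number of x ∈ GF(2^n) satisfying (u^d x + (1+u)^d)^{2^i+1} + x^{2^i+1} + 1 = 0 is independent of u, for u ranging over GF(q) ∖ GF(2). -/

import Mathlib

open Finset

noncomputable instance (n : ℕ) : Fintype (GaloisField 2 n) := Fintype.ofFinite _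

/-- The absolute trace map from `GF(2^n)` to `GF(2)`. -/
noncomputable def Tr (n : ℕ) (x : GaloisField 2 n) : ZMod 2 :=
  Algebra.trace (ZMod 2) (GaloisField 2 n) x

/-- The characteristic function of a subset `B ⊆ GF(2^n)`. -/
noncomputable def charFun {n : ℕ} (B : Set (GaloisField 2 n)) (x : GaloisField 2 n) : ZMod 2 :=
  open scoped Classical in if x ∈ B then 1 else 0

/-- The Walsh transform of a Boolean function on `GF(2^n)`, as an integer. -/
noncomputable def walsh {n : ℕ} (f : GaloisField 2 n → ZMod 2) (μ : GaloisField 2 n) : ℤ :=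
  ∑ x : GaloisField 2 n, (-1 : ℤ) ^ (f x + Tr n (μ * x)).val

/-- The orbit of a base block `B ⊆ GF(2^n)` under the general affine group `GA₁(2^n)`,
i.e. the set of all blocks `aB + b` with `a ≠ 0`. -/
def affOrbit {n : ℕ} (B : Set (GaloisField 2 n)) : Set (Set (GaloisField 2 n)) :=
  {S | ∃ a b : GaloisField 2 n, a ≠ 0 ∧ S = (fun x => a * x + b) '' B}

/-- `N_E(a,b,c)`: the number of triples `(x,y,z) ∈ E³` with `ax + by + cz = 0`. -/
noncomputable def NE {n : ℕ} (E : Set (GaloisField 2 n)) (a b c : GaloisField 2 n) : ℕ :=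
  Nat.card {t : GaloisField 2 n × GaloisField 2 n × GaloisField 2 n //
    t.1 ∈ E ∧ t.2.1 ∈ E ∧ t.2.2 ∈ E ∧ a * t.1 + b * t.2.1 + c * t.2.2 = 0}

/-- `I_B(u₁,u₂,u₃)`: the number of pairs `(x,y) ∈ GF(2^n)²` with `uᵢ x + y ∈ B` for `i = 1,2,3`. -/
noncomputable def IB {n : ℕ} (B : Set (GaloisField 2 n)) (u₁ u₂ u₃ : GaloisField 2 n) : ℕ :=
  Nat.card {p : GaloisField 2 n × GaloisField 2 n //
    u₁ * p.1 + p.2 ∈ B ∧ u₂ * p.1 + p.2 ∈ B ∧ u₃ * p.1 + p.2 ∈ B}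

/-- The incidence structure `(GF(2^n), affOrbit B)` is a 3-design: there is a `λ` such that
every 3-subset of points lies in exactly `λ` blocks of the orbit. -/
def Is3Design {n : ℕ} (B : Set (GaloisField 2 n)) : Prop :=
  ∃ lam : ℕ, ∀ u v w : GaloisField 2 n, u ≠ v → u ≠ w → v ≠ w →
    Nat.card {S : Set (GaloisField 2 n) // S ∈ affOrbit B ∧ u ∈ S ∧ v ∈ S ∧ w ∈ S} = lam

section CharacterSums

variable {K : Type*} [Field K] [Fintype K] {χ : AddChar K ℤ}

/-- The Fourier transform of an integer-valued function with respect to a character `χ`. -/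
def fourierSum (χ : AddChar K ℤ) (f : K → ℤ) (γ : K) : ℤ := ∑ x, f x * χ (γ * x)

omit [Fintype K] in
theorem isPrimitive_of_apply_one (h1 : χ 1 = -1) : χ.IsPrimitive := by
  apply AddChar.IsPrimitive.of_ne_one
  intro h
  rw [h] at h1
  norm_num at h1

theorem sum_addChar_mul [DecidableEq K] (h1 : χ 1 = -1) (b : K) :
    ∑ x, χ (x * b) = if b = 0 then (Fintype.card K : ℤ) else 0 := by
  have := AddChar.sum_mulShift b (isPrimitive_of_apply_one h1)
  simpa using this

theorem sum_addChar (h1 : χ 1 = -1) : ∑ x, χ x = 0 := by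
  classical
  simpa using sum_addChar_mul h1 (1 : K)

theorem sum_sum_mul_addChar {ι : Type*} [Fintype ι] [DecidableEq K] (h1 : χ 1 = -1)
    (f : ι → ℤ) (g : ι → K) :
    ∑ γ, ∑ i, f i * χ (γ * g i) =
      (Fintype.card K : ℤ) * ∑ i, if g i = 0 then f i else 0 := by
  rw [sum_comm, mul_sum]
  refine sum_congr rfl fun i _ => ?_
  rw [← mul_sum, sum_addChar_mul h1]
  split_ifs <;> simp [mul_comm]

variable [CharP K 2]

omit [Fintype K] in
theorem addChar_mul_self (x : K) : χ x * χ x = 1 := by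
  rw [← AddChar.map_add_eq_mul, CharTwo.add_self_eq_zero, AddChar.map_zero_eq_one]

omit [Fintype K] in
theorem addChar_eq_one_or (x : K) : χ x = 1 ∨ χ x = -1 :=
  mul_self_eq_one_iff.mp (addChar_mul_self x)

theorem sum_fourierSum_sq_mul (h1 : χ 1 = -1) (f : K → ℤ) (δ : K) :
    ∑ a, fourierSum χ f a ^ 2 * χ (a * δ) =
      (Fintype.card K : ℤ) * ∑ x, f x * f (x + δ) := by
  classical
  have h : ∀ a, fourierSum χ f a ^ 2 * χ (a * δ) =
      ∑ p : K × K, f p.1 * f p.2 * χ (a * (p.1 + p.2 + δ)) := by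
    intro a
    rw [sq, fourierSum, sum_mul_sum, ← Fintype.sum_prod_type', sum_mul]
    refine sum_congr rfl fun p _ => ?_
    rw [mul_add, mul_add, AddChar.map_add_eq_mul, AddChar.map_add_eq_mul]
    ring
  rw [sum_congr rfl fun a _ => h a, sum_sum_mul_addChar h1]
  congr 1
  rw [Fintype.sum_prod_type]
  refine sum_congr rfl fun x _ => ?_
  rw [sum_eq_single (x + δ)]
  · rw [if_pos]
    linear_combination (x + δ) * (CharTwo.two_eq_zero : (2 : K) = 0)
  · intro y _ hy
    rw [if_neg]
    intro h
    apply hy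
    linear_combination h - (x + δ) * (CharTwo.two_eq_zero : (2 : K) = 0)
  · simp

theorem sum_fourierSum_sq (h1 : χ 1 = -1) (f : K → ℤ) :
    ∑ a, fourierSum χ f a ^ 2 = (Fintype.card K : ℤ) * ∑ x, f x ^ 2 := by
  have := sum_fourierSum_sq_mul h1 f 0
  simpa [sq] using this

theorem sum_fourierSum_mul_three (h1 : χ 1 = -1) (f : K → ℤ) (a b : K) :
    ∑ γ, fourierSum χ f (a * γ) * fourierSum χ f (b * γ) * fourierSum χ f γ =
      (Fintype.card K : ℤ) * ∑ x, ∑ y, f x * f y * f (a * x + b * y) := by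
  classical
  have h : ∀ γ, fourierSum χ f (a * γ) * fourierSum χ f (b * γ) * fourierSum χ f γ =
      ∑ p : (K × K) × K,
        f p.1.1 * f p.1.2 * f p.2 * χ (γ * (a * p.1.1 + b * p.1.2 + p.2)) := by
    intro γ
    simp only [fourierSum]
    rw [sum_mul_sum, ← Fintype.sum_prod_type', sum_mul_sum, ← Fintype.sum_prod_type']
    refine sum_congr rfl fun p _ => ?_
    rw [mul_add, mul_add, AddChar.map_add_eq_mul, AddChar.map_add_eq_mul,
      show γ * (a * p.1.1) = a * γ * p.1.1 by ring, show γ * (b * p.1.2) = b * γ * p.1.2 by ring]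
    ring
  rw [sum_congr rfl fun a _ => h a, sum_sum_mul_addChar h1]
  congr 1
  rw [Fintype.sum_prod_type, Fintype.sum_prod_type]
  refine sum_congr rfl fun x _ => sum_congr rfl fun y _ => ?_
  rw [sum_eq_single (a * x + b * y)]
  · rw [if_pos]
    linear_combination (a * x + b * y) * (CharTwo.two_eq_zero : (2 : K) = 0)
  · intro z _ hz
    rw [if_neg]
    intro h
    apply hz
    linear_combination h - (a * x + b * y) * (CharTwo.two_eq_zero : (2 : K) = 0)
  · simp

theorem sum_addChar_sq_of_quadratic [DecidableEq K] (h1 : χ 1 = -1) {Q M g : K → K}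
    (hg : g.Bijective)
    (h : ∀ y z, χ (Q (y + z)) = χ (Q y) * χ (Q z) * χ (g y * M z)) :
    (∑ y, χ (Q y)) ^ 2 = (Fintype.card K : ℤ) * ∑ z, if M z = 0 then χ (Q z) else 0 := by
  have e : (∑ y, χ (Q y)) ^ 2 = ∑ y, ∑ z, χ (Q z) * χ (g y * M z) := by
    rw [sq, sum_mul]
    refine sum_congr rfl fun y _ => ?_
    rw [mul_sum, ← Equiv.sum_comp (Equiv.addLeft y)]
    refine sum_congr rfl fun z _ => ?_
    rw [Equiv.coe_addLeft, h]
    linear_combination χ (Q z) * χ (g y * M z) * addChar_mul_self (χ := χ) (Q y)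
  rw [e, ← sum_sum_mul_addChar h1]
  exact hg.sum_comp fun γ => ∑ z, χ (Q z) * χ (γ * M z)

section CubeRootOfFrobenius

variable {τ : K →+* K} (hτ : ∀ x, τ (τ (τ x)) = x ^ 2) (h3 : ∀ y : K, y ^ 3 = 1 → y = 1)

include hτ h3

omit [Fintype K] [CharP K 2] in
theorem eq_zero_or_one_of_iterate {z : K} (hz : τ (τ z) = z) : z = 0 ∨ z = 1 := by
  by_cases h0 : z = 0
  · exact Or.inl h0
  have e1 : τ z = z ^ 2 := by rw [← hτ, hz]
  have e2 : z ^ 4 = z := by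
    rw [e1, map_pow, e1] at hz
    linear_combination hz
  refine Or.inr (h3 z ?_)
  apply mul_left_cancel₀ h0
  linear_combination e2

omit [CharP K 2] in
theorem bijective_mul_ringHom : Function.Bijective fun y => y * τ y := by
  rw [← Finite.injective_iff_bijective]
  intro y w h
  simp only at h
  by_cases hw : w = 0
  · simpa [hw] using h
  have h1 : (y / w) * τ (y / w) = 1 := by
    have hw' : τ w ≠ 0 := by simpa using hw
    rw [map_div₀]
    field_simp
    linear_combination h
  set t := y / w with ht
  have t0 : t ≠ 0 := left_ne_zero_of_mul_eq_one h1
  have h2 : τ (τ t) = t := by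
    have := congrArg τ h1
    rw [map_mul, map_one] at this
    have t1 : τ t ≠ 0 := right_ne_zero_of_mul_eq_one h1
    apply mul_left_cancel₀ t1
    rw [this, ← h1, mul_comm]
  have h4 : t = 1 := (eq_zero_or_one_of_iterate hτ h3 h2).resolve_left t0
  rw [ht, div_eq_one_iff_eq hw] at h4
  exact h4

variable (h1 : χ 1 = -1) (hχ : ∀ x, χ (τ x) = χ x) (hsq : ∀ x, χ (x ^ 2) = χ x)

include h1 hχ in
theorem sum_addChar_mul_ringHom_sq (δ : K) :
    (∑ x, χ (x * τ x + δ * x)) ^ 2 = (Fintype.card K : ℤ) * (1 - χ δ) := by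
  classical
  have hM : ∀ z : K, z + τ (τ z) = 0 ↔ z = 0 ∨ z = 1 := by
    intro z
    constructor
    · intro h
      exact eq_zero_or_one_of_iterate hτ h3 (CharTwo.add_eq_zero.mp h).symm
    · rintro (rfl | rfl)
      · simp
      · simpa using CharTwo.add_self_eq_zero (1 : K)
  rw [sum_addChar_sq_of_quadratic (Q := fun x => x * τ x + δ * x) (M := fun z => z + τ (τ z))
    (g := τ) h1 (Finite.injective_iff_bijective.mp τ.injective)]
  · congr 1
    simp only [hM]
    rw [Fintype.sum_eq_add 0 1 zero_ne_one fun x hx => if_neg (by tauto)]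
    simp [AddChar.map_add_eq_mul, h1, sub_eq_add_neg]
  · intro y z
    have e : χ (y * τ z) = χ (τ y * τ (τ z)) := by rw [← map_mul, hχ]
    simp only [map_add]
    rw [show (y + z) * (τ y + τ z) + δ * (y + z) =
      (y * τ y + δ * y) + (z * τ z + δ * z) + (τ y * z + y * τ z) by ring, mul_add]
    simp only [AddChar.map_add_eq_mul, e]

include hχ hsq in
omit [Fintype K] in
theorem addChar_cubic_eq_one {a z : K} (ha : χ (a * τ a) = -1)
    (hz : z + z ^ 4 + τ (τ a) * τ (τ z) + a ^ 2 * τ z ^ 2 = 0) :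
    χ (z ^ 3 + a * (z * τ z)) = 1 := by
  have two : (2 : K) = 0 := CharTwo.two_eq_zero
  by_cases z0 : z = 0
  · simp [z0]
  obtain ⟨Y, hY⟩ : ∃ Y, Y = τ z := ⟨_, rfl⟩
  obtain ⟨Z, hZ⟩ : ∃ Z, Z = τ (τ z) := ⟨_, rfl⟩
  obtain ⟨A, hA⟩ : ∃ A, A = τ (τ a) := ⟨_, rfl⟩
  have tz : τ z = Y := hY.symm
  have tY : τ Y = Z := by rw [hY, hZ]
  have tZ : τ Z = z ^ 2 := by rw [hZ, hτ]
  have tA : τ A = a ^ 2 := by rw [hA, hτ]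
  have Y0 : Y ≠ 0 := by rw [hY]; simpa using z0
  have Z0 : Z ≠ 0 := by rw [hZ]; simpa using z0
  rw [← hA, ← hZ, tz] at hz
  rw [tz]
  obtain ⟨ε, hε⟩ : ∃ ε, ε = z ^ 3 + Y ^ 3 + Z ^ 3 + A * Z * z ^ 2 := ⟨_, rfl⟩
  have tε : τ ε = ε := by
    rw [hε]
    simp only [map_add, map_mul, map_pow, tz, tY, tZ, tA]
    linear_combination z ^ 2 * hz - (z ^ 3 + A * Z * z ^ 2) * two
  have hε2 : ε = 0 ∨ ε = 1 := eq_zero_or_one_of_iterate hτ h3 (by rw [tε, tε])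
  have hr : χ (a * (z * Y)) = χ (A * Z * z ^ 2) := by
    rw [← hχ, ← hχ]
    simp only [map_mul, tz, tY, tZ, ← hA, mul_assoc]
  have hp1 : χ (Y ^ 3) = χ (z ^ 3) := by rw [← tz, ← map_pow, hχ]
  have hp2 : χ (Z ^ 3) = χ (z ^ 3) := by rw [← tY, ← map_pow, hχ, hp1]
  have hQ : χ (z ^ 3 + a * (z * Y)) = χ ε := by
    rw [hε]
    simp only [AddChar.map_add_eq_mul, hr, hp1, hp2]
    linear_combination - χ (z ^ 3) * χ (A * Z * z ^ 2) * addChar_mul_self (χ := χ) (z ^ 3)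
  rw [hQ]
  rcases hε2 with h | h
  · simp [h]
  exfalso
  have eA : A = (z ^ 3 + Y ^ 3 + Z ^ 3 + 1) / (Z * z ^ 2) := by
    rw [eq_div_iff (mul_ne_zero Z0 (pow_ne_zero 2 z0))]
    linear_combination h - hε - (z ^ 3 + Y ^ 3 + Z ^ 3) * two
  have ea : a ^ 2 = (Y ^ 3 + Z ^ 3 + z ^ 6 + 1) / (z ^ 2 * Y ^ 2) := by
    rw [← tA, eA]
    simp only [map_div₀, map_add, map_mul, map_pow, map_one, tz, tY, tZ]
    ring_nf
  have hprod : A * a ^ 2 =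
      ((z * Z / Y) ^ 2 + z ^ 2 * Y / Z) + (Y ^ 4 / (Z * z ^ 4) + Z ^ 2 / (z * Y ^ 2))
        + (z ^ 5 / (Z * Y ^ 2) + Z ^ 5 / (Y ^ 2 * z ^ 4))
        + (z ^ 2 / (Z * Y ^ 2) + Y / (z * Z))
        + (1 / (z * Y ^ 2 * Z) + 1 / (Z * z ^ 4 * Y ^ 2))
        + 2 * (Y * Z ^ 2 / z ^ 4 + Z ^ 2 / (z ^ 4 * Y ^ 2) + Y / (Z * z ^ 4)) := by
    rw [eA, ea]
    field_simp
    ring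
  have hc : χ (A * a ^ 2) = 1 := by
    have k1 : χ (z ^ 2 * Y / Z) = χ ((z * Z / Y) ^ 2) := by
      rw [hsq, ← hχ (z * Z / Y)]
      simp only [map_div₀, map_mul, tz, tY, tZ]
      congr 1
      ring
    have k2 : χ (Z ^ 2 / (z * Y ^ 2)) = χ (Y ^ 4 / (Z * z ^ 4)) := by
      rw [← hsq, ← hχ (Y ^ 4 / (Z * z ^ 4))]
      simp only [map_div₀, map_mul, map_pow, tz, tY, tZ]
      congr 1
      ring
    have k3 : χ (Z ^ 5 / (Y ^ 2 * z ^ 4)) = χ (z ^ 5 / (Z * Y ^ 2)) := by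
      rw [← hχ (z ^ 5 / (Z * Y ^ 2)), ← hχ (τ (z ^ 5 / (Z * Y ^ 2)))]
      simp only [map_div₀, map_mul, map_pow, tz, tY, tZ]
      congr 1
      ring
    have k4 : χ (Y / (z * Z)) = χ (z ^ 2 / (Z * Y ^ 2)) := by
      rw [← hsq, ← hχ (z ^ 2 / (Z * Y ^ 2))]
      simp only [map_div₀, map_mul, map_pow, tz, tY, tZ]
      congr 1
      ring
    have k5 : χ (1 / (Z * z ^ 4 * Y ^ 2)) = χ (1 / (z * Y ^ 2 * Z)) := by
      rw [← hχ (1 / (z * Y ^ 2 * Z)), ← hχ (τ (1 / (z * Y ^ 2 * Z)))]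
      simp only [map_div₀, map_mul, map_pow, map_one, tz, tY, tZ]
      congr 1
      ring
    rw [hprod, two, zero_mul, add_zero]
    simp only [AddChar.map_add_eq_mul, k1, k2, k3, k4, k5, addChar_mul_self, mul_one]
  have : χ (A * a ^ 2) = χ (a * τ a) := by
    rw [← tA, hA, ← map_mul, hχ, ← map_mul, hχ]
  rw [← this, hc] at ha
  norm_num at ha

include h1 hχ hsq in
theorem sum_addChar_cubic_sq (hns : ¬ IsSquare (Fintype.card K : ℤ)) (a : K) :
    (∑ x, χ (x ^ 3 + a * (x * τ x))) ^ 2 = (Fintype.card K : ℤ) * (1 - χ (a * τ a)) := by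
  classical
  have hqpos : (0 : ℤ) < Fintype.card K := by exact_mod_cast Fintype.card_pos
  have hsqbij : Function.Bijective fun y : K => y ^ 2 := by
    have : (fun y : K => y ^ 2) = fun y => τ (τ (τ y)) := by
      funext y
      rw [hτ]
    rw [this, ← Finite.injective_iff_bijective]
    exact τ.injective.comp (τ.injective.comp τ.injective)
  have key : ∀ a : K, (∑ x, χ (x ^ 3 + a * (x * τ x))) ^ 2 = (Fintype.card K : ℤ) *
      ∑ z, if z + z ^ 4 + τ (τ a) * τ (τ z) + a ^ 2 * τ z ^ 2 = 0
        then χ (z ^ 3 + a * (z * τ z)) else 0 := by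
    intro a
    refine sum_addChar_sq_of_quadratic (Q := fun x => x ^ 3 + a * (x * τ x))
      (M := fun z => z + z ^ 4 + τ (τ a) * τ (τ z) + a ^ 2 * τ z ^ 2) h1 hsqbij ?_
    intro y z
    have e1 : χ (y * z ^ 2) = χ (y ^ 2 * z ^ 4) := by
      rw [← hsq]
      congr 1
      ring
    have e2 : χ (a * (y * τ z)) = χ (y ^ 2 * (a ^ 2 * τ z ^ 2)) := by
      rw [← hsq]
      congr 1
      ring
    have e3 : χ (a * (z * τ y)) = χ (y ^ 2 * (τ (τ a) * τ (τ z))) := by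
      rw [← hτ y, ← hχ, ← hχ]
      simp only [map_mul]
      congr 1
      ring
    simp only [map_add]
    rw [show (y + z) ^ 3 + a * ((y + z) * (τ y + τ z)) =
      (y ^ 3 + a * (y * τ y)) + (z ^ 3 + a * (z * τ z)) + (y ^ 2 * z + y * z ^ 2
        + a * (z * τ y) + a * (y * τ z)) + 2 * (y ^ 2 * z + y * z ^ 2) by ring,
      (CharTwo.two_eq_zero : (2 : K) = 0), zero_mul, add_zero, mul_add, mul_add, mul_add]
    rw [AddChar.map_add_eq_mul, AddChar.map_add_eq_mul]
    simp only [AddChar.map_add_eq_mul, e1, e2, e3]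
  have hlow : ∀ a : K, (Fintype.card K : ℤ) * (1 - χ (a * τ a)) ≤
      (∑ x, χ (x ^ 3 + a * (x * τ x))) ^ 2 := by
    intro a
    rcases addChar_eq_one_or (χ := χ) (a * τ a) with h | h
    · rw [h]
      simpa using sq_nonneg _
    · have hcount := key a
      rw [sum_congr rfl fun z _ => (ite_congr rfl (fun hz =>
        addChar_cubic_eq_one hτ h3 hχ hsq h hz) fun _ => rfl), sum_boole] at hcount
      obtain ⟨N, hN⟩ : ∃ N : ℕ, N = #{z | z + z ^ 4 + τ (τ a) * τ (τ z) + a ^ 2 * τ z ^ 2 = 0} :=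
        ⟨_, rfl⟩
      rw [← hN] at hcount
      have h0 : N ≠ 0 := by
        rw [hN]
        apply card_ne_zero_of_mem (a := 0)
        simp
      have hone : N ≠ 1 := by
        rintro rfl
        apply hns
        refine ⟨∑ x, χ (x ^ 3 + a * (x * τ x)), ?_⟩
        rw [← sq, hcount]
        simp
      have h2 : (2 : ℤ) ≤ N := by
        have : 2 ≤ N := by omega
        exact_mod_cast this
      rw [hcount, h]
      exact mul_le_mul_of_nonneg_left (by linarith) hqpos.le
  have hbij : Function.Bijective fun y => y * τ y := bijective_mul_ringHom hτ h3
  have htot : ∑ a : K, (∑ x, χ (x ^ 3 + a * (x * τ x))) ^ 2 =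
      ∑ a : K, (Fintype.card K : ℤ) * (1 - χ (a * τ a)) := by
    have e : ∀ a : K, ∑ x, χ (x ^ 3 + a * (x * τ x)) = fourierSum χ
        (fun u => χ ((Equiv.ofBijective _ hbij).symm u ^ 3)) a := by
      intro a
      rw [fourierSum]
      refine Eq.trans ?_ (hbij.sum_comp _)
      refine sum_congr rfl fun x _ => ?_
      have hx : (Equiv.ofBijective _ hbij).symm (x * τ x) = x :=
        Equiv.ofBijective_symm_apply_apply _ hbij x
      rw [AddChar.map_add_eq_mul, hx]
    simp only [e]
    rw [sum_fourierSum_sq h1, ← mul_sum, sum_sub_distrib, hbij.sum_comp fun x => χ x, sum_addChar h1]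
    simp [sq, addChar_mul_self]
  exact ((sum_eq_sum_iff_of_le fun a _ => hlow a).mp htot.symm a (mem_univ a)).symm

end CubeRootOfFrobenius
section SignFunction

variable (h1 : χ 1 = -1) {m s d : ℕ} (hd0 : d ≠ 0) (hds : ∀ x : K, (x ^ d) ^ s = x)

include h1 in
theorem sum_addChar_pow_mul_shift
    (hV : ∀ a : K, fourierSum χ (fun x => χ (x ^ s)) a ^ 2 =
      (Fintype.card K : ℤ) * (1 - χ (a ^ m))) [DecidableEq K] (δ : K) :
    ∑ x, χ (x ^ s) * χ ((x + δ) ^ s) =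
      (if δ = 0 then (Fintype.card K : ℤ) else 0) - fourierSum χ (fun x => χ (x ^ m)) δ := by
  have hq : (Fintype.card K : ℤ) ≠ 0 := by exact_mod_cast Fintype.card_ne_zero
  apply mul_left_cancel₀ hq
  rw [← sum_fourierSum_sq_mul h1, ← sum_addChar_mul h1, fourierSum, ← sum_sub_distrib, mul_sum]
  refine sum_congr rfl fun a _ => ?_
  rw [hV, mul_comm δ]
  ring

/-- One minus the number of preimages of `y` under `x ↦ (x + 1) ^ s + x ^ s`. -/
def derivSign [DecidableEq K] (s : ℕ) (y : K) : ℤ :=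
  1 - ∑ x, if (x + 1) ^ s + x ^ s = y then 1 else 0

include h1 hd0 hds in
theorem fourierSum_derivSign [DecidableEq K]
    (hA : ∀ δ, ∑ x, χ (x ^ s) * χ ((x + δ) ^ s) =
      (if δ = 0 then (Fintype.card K : ℤ) else 0) - fourierSum χ (fun x => χ (x ^ m)) δ) (γ : K) :
    fourierSum χ (derivSign s) γ = fourierSum χ (fun x => χ (x ^ m)) (γ ^ d) := by
  have e : fourierSum χ (derivSign s) γ =
      ∑ y, χ (y * γ) - ∑ x : K, χ (γ * ((x + 1) ^ s + x ^ s)) := by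
    simp only [fourierSum, derivSign, sub_mul, sum_sub_distrib, one_mul, sum_mul, ite_mul, zero_mul,
      mul_comm γ]
    congr 1
    rw [sum_comm]
    simp
  rw [e, sum_addChar_mul h1]
  have hA' := hA (γ ^ d)
  have hγ : γ ^ d = 0 ↔ γ = 0 := pow_eq_zero_iff hd0
  simp only [hγ] at hA'
  suffices h : ∑ x : K, χ (γ * ((x + 1) ^ s + x ^ s)) =
      ∑ x, χ (x ^ s) * χ ((x + γ ^ d) ^ s) by
    rw [h, hA']
    ring
  by_cases h0 : γ = 0
  · subst h0
    simp [addChar_mul_self, zero_pow hd0]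
  · have hb : Function.Bijective fun x : K => γ ^ d * x :=
      mulLeft_bijective₀ _ (pow_ne_zero d h0)
    refine Eq.trans ?_ (hb.sum_comp fun x => χ (x ^ s) * χ ((x + γ ^ d) ^ s))
    refine sum_congr rfl fun x _ => ?_
    rw [← AddChar.map_add_eq_mul, ← mul_add_one, mul_pow, mul_pow, hds]
    congr 1
    ring

include h1 in
theorem derivSign_eq [DecidableEq K]
    (hd : Function.Bijective fun x : K => x ^ d)
    (hF : ∀ γ, fourierSum χ (derivSign s) γ = fourierSum χ (fun x => χ (x ^ m)) (γ ^ d)) (y : K) :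
    ((∃ x : K, y = (x + 1) ^ s + x ^ s) → derivSign s y = -1) ∧
    ((¬ ∃ x : K, y = (x + 1) ^ s + x ^ s) → derivSign s y = 1) := by
  have two : (2 : K) = 0 := CharTwo.two_eq_zero
  have hq : (Fintype.card K : ℤ) ≠ 0 := by exact_mod_cast Fintype.card_ne_zero
  have hsq : ∑ y : K, derivSign s y ^ 2 = Fintype.card K := by
    apply mul_left_cancel₀ hq
    rw [← sum_fourierSum_sq h1]
    simp only [hF]
    rw [hd.sum_comp fun γ => fourierSum χ (fun x => χ (x ^ m)) γ ^ 2, sum_fourierSum_sq h1]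
    simp [sq, addChar_mul_self]
  have hN : ∀ y : K, derivSign s y = 1 - (#{x : K | (x + 1) ^ s + x ^ s = y} : ℤ) := by
    intro y
    rw [derivSign, sum_boole]
  have htwo : ∀ x y : K, (x + 1) ^ s + x ^ s = y →
      2 ≤ #{x : K | (x + 1) ^ s + x ^ s = y} := by
    intro x y hx
    have hne : x ≠ x + 1 := by simp
    rw [← card_pair hne]
    apply card_le_card
    intro w hw
    rw [mem_insert, mem_singleton] at hw
    rw [mem_filter]
    refine ⟨mem_univ w, ?_⟩
    rcases hw with rfl | rfl
    · exact hx
    · rw [show x + 1 + 1 = x by linear_combination two, add_comm, hx]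
  have hle : ∀ y x : K, y = (x + 1) ^ s + x ^ s → derivSign s y ≤ -1 := by
    intro y x hx
    have := htwo x y hx.symm
    rw [hN]
    zify at this
    linarith
  have hone : ∀ y : K, (¬ ∃ x : K, y = (x + 1) ^ s + x ^ s) → derivSign s y = 1 := by
    intro y hy
    rw [hN, filter_eq_empty_iff.mpr]
    · simp
    · intro x _ hx
      exact hy ⟨x, hx.symm⟩
  have hge : ∀ y : K, (1 : ℤ) ≤ derivSign s y ^ 2 := by
    intro y
    by_cases hy : ∃ x : K, y = (x + 1) ^ s + x ^ s
    · obtain ⟨x, hx⟩ := hy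
      have := hle y x hx
      nlinarith
    · rw [hone y hy]
      norm_num
  have heq : derivSign s y ^ 2 = 1 := by
    refine ((sum_eq_sum_iff_of_le fun y _ => hge y).mp ?_ y (mem_univ y)).symm
    rw [hsq]
    simp
  refine ⟨?_, hone y⟩
  rintro ⟨x, hx⟩
  have := hle y x hx
  rcases mul_self_eq_one_iff.mp (by rwa [sq] at heq) with h | h <;> linarith

end SignFunction
section TripleSum

variable (h1 : χ 1 = -1) {m d : ℕ} (hd0 : d ≠ 0) (hd : Function.Bijective fun x : K => x ^ d)
  (hm0 : m ≠ 0) (hm : Function.Bijective fun x : K => x ^ m)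

include h1 hm0 hm in
theorem sum_sum_addChar_pow [DecidableEq K] (a b : K) (hb : b ≠ 1) :
    ∑ x, ∑ y, χ (x ^ m) * χ (y ^ m) * χ ((a * x + b * y) ^ m) =
      (Fintype.card K : ℤ) * (#{x : K | (b * x + a) ^ m + x ^ m + 1 = 0} - 1) := by
  have hx : ∀ x : K, ∑ y, χ (x ^ m) * χ (y ^ m) * χ ((a * x + b * y) ^ m) =
      ∑ y, 1 * χ (x ^ m * ((b * y + a) ^ m + y ^ m + 1)) -
        if x = 0 then (Fintype.card K : ℤ) else 0 := by
    intro x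
    by_cases h0 : x = 0
    · subst h0
      have hb1 : 1 + b ^ m ≠ 0 := by
        intro h
        rw [CharTwo.add_eq_zero] at h
        apply hb
        apply hm.injective
        simp [← h]
      have e : ∀ y : K, χ (0 ^ m) * χ (y ^ m) * χ ((a * 0 + b * y) ^ m) =
          χ (y ^ m * (1 + b ^ m)) := by
        intro y
        rw [zero_pow hm0, AddChar.map_zero_eq_one, one_mul, ← AddChar.map_add_eq_mul, mul_zero,
          zero_add, mul_pow]
        congr 1
        ring
      rw [sum_congr rfl fun y _ => e y, hm.sum_comp fun y => χ (y * (1 + b ^ m)),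
        sum_addChar_mul h1, if_neg hb1]
      simp [zero_pow hm0]
    · rw [if_neg h0, sub_zero]
      refine Eq.trans ((mulLeft_bijective₀ x h0).sum_comp _).symm (sum_congr rfl fun y _ => ?_)
      rw [← AddChar.map_add_eq_mul, ← AddChar.map_add_eq_mul, one_mul,
        show a * x + b * (x * y) = x * (b * y + a) by ring, mul_pow, mul_pow]
      congr 1
      ring
  rw [sum_congr rfl fun x _ => hx x, sum_sub_distrib,
    hm.sum_comp fun x => ∑ y, 1 * χ (x * ((b * y + a) ^ m + y ^ m + 1)),
    sum_sum_mul_addChar h1, sum_boole]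
  simp
  ring

include h1 hm0 hm hd in
theorem sum_sum_sign [DecidableEq K] {F : K → ℤ}
    (hF : ∀ γ, fourierSum χ F γ = fourierSum χ (fun x => χ (x ^ m)) (γ ^ d)) {t : K}
    (ht1 : t ≠ 1) :
    ∑ x, ∑ y, F x * F y * F ((t + 1) * x + t * y) = (Fintype.card K : ℤ) *
      (#{x : K | (t ^ d * x + (1 + t) ^ d) ^ m + x ^ m + 1 = 0} - 1) := by
  have hq : (Fintype.card K : ℤ) ≠ 0 := by exact_mod_cast Fintype.card_ne_zero
  have htd : t ^ d ≠ 1 := by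
    intro h
    apply ht1
    apply hd.injective
    simpa using h
  rw [← sum_sum_addChar_pow h1 hm0 hm _ _ htd]
  apply mul_left_cancel₀ hq
  rw [← sum_fourierSum_mul_three h1, ← sum_fourierSum_mul_three h1 fun x => χ (x ^ m)]
  simp only [hF, mul_pow, add_comm t]
  exact hd.sum_comp fun γ => fourierSum χ (fun x => χ (x ^ m)) ((1 + t) ^ d * γ) *
    fourierSum χ (fun x => χ (x ^ m)) (t ^ d * γ) * fourierSum χ (fun x => χ (x ^ m)) γ

end TripleSum

section AffineOrbit

variable (h1 : χ 1 = -1) {m d : ℕ} (hd0 : d ≠ 0) (hd : Function.Bijective fun x : K => x ^ d)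
  {F : K → ℤ} (hF : ∀ γ, fourierSum χ F γ = fourierSum χ (fun x => χ (x ^ m)) (γ ^ d))
  (hG : ∀ δ, fourierSum χ (fun x => χ (x ^ m)) δ ^ 2 = (Fintype.card K : ℤ) * (1 - χ δ))

theorem fourierSum_comp_affine {a : K} (ha : a ≠ 0) (b γ : K) :
    fourierSum χ (fun x => F ((x + b) / a)) γ = χ (γ * b) * fourierSum χ F (a * γ) := by
  have hb : Function.Bijective fun x : K => a * x + b := by
    refine ⟨fun x y h => mul_left_cancel₀ ha (add_right_cancel h), fun y => ⟨(y - b) / a, ?_⟩⟩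
    field_simp
    ring
  rw [fourierSum, ← hb.sum_comp, fourierSum, mul_sum]
  refine sum_congr rfl fun x _ => ?_
  rw [add_assoc, CharTwo.add_self_eq_zero, add_zero, mul_div_cancel_left₀ _ ha, mul_add,
    AddChar.map_add_eq_mul]
  ring_nf

include h1 hd0 hd hF hG in
theorem affine_eq_of_comp_eq {a b a' b' : K} (ha : a ≠ 0) (ha' : a' ≠ 0)
    (h : ∀ x, F ((x + b) / a) = F ((x + b') / a')) : a = a' ∧ b = b' := by
  have hq : (Fintype.card K : ℤ) ≠ 0 := by exact_mod_cast Fintype.card_ne_zero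
  have key : ∀ γ, χ (γ * b) * fourierSum χ (fun x => χ (x ^ m)) ((a * γ) ^ d) =
      χ (γ * b') * fourierSum χ (fun x => χ (x ^ m)) ((a' * γ) ^ d) := by
    intro γ
    rw [← hF, ← hF, ← fourierSum_comp_affine ha, ← fourierSum_comp_affine ha']
    simp only [h]
  have haa : a = a' := by
    apply hd.injective
    by_contra hne
    simp only at hne
    have hsum : ∑ δ, χ (δ * (a ^ d + a' ^ d)) = Fintype.card K := by
      have : ∀ δ, χ (δ * (a ^ d + a' ^ d)) = 1 := by
        intro δ
        obtain ⟨γ, rfl⟩ := hd.surjective δ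
        have hk := congrArg (· ^ 2) (key γ)
        simp only [mul_pow _ _ 2] at hk
        rw [hG, hG, sq (χ _), sq (χ _), addChar_mul_self, addChar_mul_self, one_mul, one_mul] at hk
        have := mul_left_cancel₀ hq hk
        have h2 : χ ((a * γ) ^ d) = χ ((a' * γ) ^ d) := by linarith
        simp only
        rw [mul_add, mul_comm, mul_comm _ (a' ^ d), ← mul_pow, ← mul_pow, AddChar.map_add_eq_mul, h2,
          addChar_mul_self]
      simp [this]
    classical
    rw [sum_addChar_mul h1, if_neg] at hsum
    · exact hq hsum.symm
    · rwa [CharTwo.add_eq_zero]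
  refine ⟨haa, ?_⟩
  subst haa
  by_contra hne
  have hor : ∀ γ, χ (γ * (b + b')) = 1 ∨ χ ((a * γ) ^ d) = 1 := by
    intro γ
    by_cases h0 : fourierSum χ (fun x => χ (x ^ m)) ((a * γ) ^ d) = 0
    · right
      have := hG ((a * γ) ^ d)
      rw [h0] at this
      have h2 : 1 - χ ((a * γ) ^ d) = 0 := by
        apply mul_left_cancel₀ hq
        rw [← this]
        simp
      linarith
    · left
      rw [mul_add, AddChar.map_add_eq_mul, mul_right_cancel₀ h0 (key γ), addChar_mul_self]
  have hb : Function.Bijective fun γ : K => (a * γ) ^ d :=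
    hd.comp (mulLeft_bijective₀ a ha)
  have hsum : ∑ γ, (1 + χ (γ * (b + b')) * χ ((a * γ) ^ d)) = 0 := by
    classical
    have e : ∀ γ, 1 + χ (γ * (b + b')) * χ ((a * γ) ^ d) =
        χ (γ * (b + b')) + χ ((a * γ) ^ d) := by
      intro γ
      rcases hor γ with h | h <;> rw [h] <;> ring
    rw [sum_congr rfl fun γ _ => e γ, sum_add_distrib, hb.sum_comp fun x => χ x, sum_addChar h1,
      sum_addChar_mul h1, if_neg, add_zero]
    rwa [CharTwo.add_eq_zero]
  have h0 := (sum_eq_zero_iff_of_nonneg fun γ _ => ?_).mp hsum 0 (mem_univ 0)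
  · simp [zero_pow hd0] at h0
  · rcases addChar_eq_one_or (χ := χ) (γ * (b + b')) with h | h <;>
    rcases addChar_eq_one_or (χ := χ) ((a * γ) ^ d) with h' | h' <;> rw [h, h'] <;> norm_num

end AffineOrbit
section BlockCount

omit [Fintype K] in
theorem mem_image_affine {a b z : K} (ha : a ≠ 0) {B : Set K} :
    z ∈ (fun x => a * x + b) '' B ↔ (z + b) / a ∈ B := by
  constructor
  · rintro ⟨x, hx, rfl⟩
    simp only
    rwa [add_assoc, CharTwo.add_self_eq_zero, add_zero, mul_div_cancel_left₀ _ ha]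
  · intro h
    refine ⟨_, h, ?_⟩
    simp only
    rw [mul_div_cancel₀ _ ha, add_assoc, CharTwo.add_self_eq_zero, add_zero]

omit [Fintype K] in
theorem card_blocks_eq {B : Set K}
    (hinj : ∀ {a b a' b' : K}, a ≠ 0 → a' ≠ 0 →
      (fun x => a * x + b) '' B = (fun x => a' * x + b') '' B → a = a' ∧ b = b')
    {u v w : K} (huv : u ≠ v) :
    Nat.card {S : Set K //
        (∃ a b : K, a ≠ 0 ∧ S = (fun x => a * x + b) '' B) ∧ u ∈ S ∧ v ∈ S ∧ w ∈ S} =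
      Nat.card {p : K × K // p.1 ∈ B ∧ p.2 ∈ B ∧
        ((u + w) / (u + v) + 1) * p.1 + (u + w) / (u + v) * p.2 ∈ B ∧ p.1 ≠ p.2} := by
  have two : (2 : K) = 0 := CharTwo.two_eq_zero
  have huv' : u + v ≠ 0 := by rwa [Ne, CharTwo.add_eq_zero]
  symm
  have ha : ∀ p : K × K, p.1 ≠ p.2 → (u + v) / (p.1 + p.2) ≠ 0 := fun p hp =>
    div_ne_zero huv' (by rwa [Ne, CharTwo.add_eq_zero])
  have eu : ∀ p : K × K, p.1 ≠ p.2 → (u + v) / (p.1 + p.2) * p.1 +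
      (u + (u + v) / (p.1 + p.2) * p.1) = u := by
    intro p hp
    linear_combination (u + v) / (p.1 + p.2) * p.1 * two
  have ev : ∀ p : K × K, p.1 ≠ p.2 → (u + v) / (p.1 + p.2) * p.2 +
      (u + (u + v) / (p.1 + p.2) * p.1) = v := by
    intro p hp
    have : p.1 + p.2 ≠ 0 := by rwa [Ne, CharTwo.add_eq_zero]
    field_simp
    linear_combination (u * (p.1 + p.2)) * two
  have ew : ∀ p : K × K, p.1 ≠ p.2 → (u + v) / (p.1 + p.2) *
      (((u + w) / (u + v) + 1) * p.1 + (u + w) / (u + v) * p.2) +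
      (u + (u + v) / (p.1 + p.2) * p.1) = w := by
    intro p hp
    have : p.1 + p.2 ≠ 0 := by rwa [Ne, CharTwo.add_eq_zero]
    field_simp
    linear_combination (u * (p.1 + p.2) + (u + v) * p.1) * two
  refine Nat.card_congr (Equiv.ofBijective (fun p => ⟨(fun x => (u + v) / (p.1.1 + p.1.2) * x +
    (u + (u + v) / (p.1.1 + p.1.2) * p.1.1)) '' B, ⟨_, _, ha p.1 p.2.2.2.2, rfl⟩,
    ⟨_, p.2.1, eu p.1 p.2.2.2.2⟩, ⟨_, p.2.2.1, ev p.1 p.2.2.2.2⟩,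
    ⟨_, p.2.2.2.1, ew p.1 p.2.2.2.2⟩⟩) ⟨?_, ?_⟩)
  · rintro ⟨p, hp⟩ ⟨p', hp'⟩ h
    have hp4 := hp.2.2.2
    have hp4' := hp'.2.2.2
    obtain ⟨h1, h2⟩ := hinj (ha p hp4) (ha p' hp4') (congrArg Subtype.val h)
    have e1 := (eu p hp4).trans (eu p' hp4').symm
    have e2 := (ev p hp4).trans (ev p' hp4').symm
    rw [h2] at e1 e2
    rw [h1] at e1 e2
    exact Subtype.ext (Prod.ext (mul_left_cancel₀ (ha p' hp4') (add_right_cancel e1))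
      (mul_left_cancel₀ (ha p' hp4') (add_right_cancel e2)))
  · rintro ⟨S, ⟨a, b, ha0, rfl⟩, ⟨x, hx, rfl⟩, ⟨y, hy, rfl⟩, ⟨z, hz, rfl⟩⟩
    simp only at huv huv' eu ev ew ha ⊢
    have hxy : x ≠ y := by
      rintro rfl
      exact huv rfl
    have hxy' : x + y ≠ 0 := by rwa [Ne, CharTwo.add_eq_zero]
    have hz' : ((a * x + b + (a * z + b)) / (a * x + b + (a * y + b)) + 1) * x +
        (a * x + b + (a * z + b)) / (a * x + b + (a * y + b)) * y = z := by
      field_simp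
      linear_combination (a * x * x + a * x * y + 2 * b * x + b * y - b * z) * two
    refine ⟨⟨(x, y), hx, hy, ?_, hxy⟩, ?_⟩
    · simpa only [hz'] using hz
    · have ea : (a * x + b + (a * y + b)) / (x + y) = a := by
        field_simp
        linear_combination b * two
      have eb : a * x + b + a * x = b := by linear_combination a * x * two
      simp only [ea, eb]

omit [CharP K 2] in
theorem sum_comp_affine (F : K → ℤ) {c : K} (hc : c ≠ 0) (z : K) :
    ∑ y, F (z + c * y) = ∑ y, F y :=
  ((Equiv.addLeft z).bijective.comp (mulLeft_bijective₀ c hc)).sum_comp F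

theorem eight_mul_card_triples [DecidableEq K] {F : K → ℤ} {B : Set K} [DecidablePred (· ∈ B)]
    (hB : ∀ x, F x = if x ∈ B then -1 else 1) (h0 : ∑ x, F x = 0) {t : K} (ht0 : t ≠ 0)
    (ht1 : t ≠ 1) :
    8 * (Nat.card {p : K × K // p.1 ∈ B ∧ p.2 ∈ B ∧ (t + 1) * p.1 + t * p.2 ∈ B ∧ p.1 ≠ p.2} : ℤ) =
      (Fintype.card K : ℤ) ^ 2 - 4 * Fintype.card K -
        ∑ x, ∑ y, F x * F y * F ((t + 1) * x + t * y) := by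
  have ht1' : t + 1 ≠ 0 := by rwa [Ne, CharTwo.add_eq_zero]
  have hshift : ∀ c : K, c ≠ 0 → ∀ z : K, ∑ y, F (z + c * y) = 0 := fun c hc z =>
    (sum_comp_affine F hc z).trans h0
  rw [Nat.card_eq_fintype_card, Fintype.card_subtype, card_filter]
  push_cast
  rw [mul_sum, Fintype.sum_prod_type]
  have hterm : ∀ x y : K, (8 : ℤ) * (if x ∈ B ∧ y ∈ B ∧ (t + 1) * x + t * y ∈ B ∧ x ≠ y
      then 1 else 0) = (1 - F x) * (1 - F y) * (1 - F ((t + 1) * x + t * y)) -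
      if x = y then 4 * (1 - F x) else 0 := by
    intro x y
    rw [hB x, hB y, hB (_ + _)]
    by_cases hxy : x = y
    · subst hxy
      have : (t + 1) * x + t * x = x := by
        linear_combination t * x * (CharTwo.two_eq_zero : (2 : K) = 0)
      simp only [this]
      split_ifs <;> simp_all
    · split_ifs <;> simp_all
  have hrow : ∀ x : K, ∑ y, (8 : ℤ) * (if x ∈ B ∧ y ∈ B ∧ (t + 1) * x + t * y ∈ B ∧ x ≠ y
      then 1 else 0) = (1 - F x) * Fintype.card K - 4 * (1 - F x) +
      (∑ y, F y * F ((t + 1) * x + t * y) - ∑ y, F x * F y * F ((t + 1) * x + t * y)) := by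
    intro x
    rw [sum_congr rfl fun y _ => hterm x y, sum_sub_distrib, sum_ite_eq, if_pos (mem_univ x)]
    have e : ∀ y, (1 - F x) * (1 - F y) * (1 - F ((t + 1) * x + t * y)) =
        (1 - F x) - (1 - F x) * F y - (1 - F x) * F ((t + 1) * x + t * y)
          + F y * F ((t + 1) * x + t * y) - F x * F y * F ((t + 1) * x + t * y) := by
      intro y
      ring
    rw [sum_congr rfl fun y _ => e y]
    simp only [sum_sub_distrib, sum_add_distrib, ← mul_sum, h0, hshift t ht0, sum_const, card_univ,
      nsmul_eq_mul]
    ring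
  have hcross : ∑ x, ∑ y, F y * F ((t + 1) * x + t * y) = 0 := by
    rw [sum_comm]
    apply sum_eq_zero
    intro y _
    rw [← mul_sum]
    simp only [add_comm _ (t * y)]
    rw [hshift _ ht1', mul_zero]
  rw [sum_congr rfl fun x _ => hrow x, sum_add_distrib, sum_sub_distrib, sum_sub_distrib, hcross,
    ← sum_mul, ← mul_sum]
  simp only [sum_sub_distrib, h0, sum_const, card_univ, nsmul_eq_mul]
  ring

theorem sum_sum_sum_sign {F : K → ℤ} (hF2 : ∀ x, F x * F x = 1) (h0 : ∑ x, F x = 0) :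
    ∑ t, ∑ x, ∑ y, F x * F y * F ((t + 1) * x + t * y) = 0 := by
  classical
  have hline : ∀ x y : K, ∑ t, F x * F y * F ((t + 1) * x + t * y) =
      if x = y then Fintype.card K * F x else 0 := by
    intro x y
    rw [← mul_sum]
    have e : ∀ t : K, (t + 1) * x + t * y = x + (x + y) * t := fun t => by ring
    simp only [e]
    split_ifs with h
    · subst h
      simp [CharTwo.add_self_eq_zero, hF2]
    · rw [sum_comp_affine F (by rwa [Ne, CharTwo.add_eq_zero]), h0, mul_zero]
  rw [sum_comm]
  have : ∀ x : K, ∑ t, ∑ y, F x * F y * F ((t + 1) * x + t * y) = Fintype.card K * F x := by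
    intro x
    rw [sum_comm]
    simp [hline]
  simp only [this, ← mul_sum, h0, mul_zero]

theorem sum_sum_sign_zero_and_one {F : K → ℤ} (hF2 : ∀ x, F x * F x = 1) (h0 : ∑ x, F x = 0) :
    (∑ x, ∑ y, F x * F y * F ((0 + 1) * x + 0 * y) = 0) ∧
      ∑ x, ∑ y, F x * F y * F ((1 + 1) * x + 1 * y) = 0 := by
  constructor
  · have : ∀ x y : K, F x * F y * F ((0 + 1) * x + 0 * y) = F y := by
      intro x y
      rw [zero_add, one_mul, zero_mul, add_zero]
      linear_combination F y * hF2 x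
    simp only [this, h0, sum_const_zero]
  · have : ∀ x y : K, F x * F y * F ((1 + 1) * x + 1 * y) = F x := by
      intro x y
      rw [CharTwo.add_self_eq_zero, one_mul, zero_mul, zero_add]
      linear_combination F x * hF2 y
    simp only [this, sum_const, ← smul_sum, h0, smul_zero]

end BlockCount
section Design

theorem design_iff_card_const (h1 : χ 1 = -1) {m s d : ℕ} (hm0 : m ≠ 0) (hd0 : d ≠ 0)
    (hm : Function.Bijective fun x : K => x ^ m) (hd : Function.Bijective fun x : K => x ^ d)
    (hds : ∀ x : K, (x ^ d) ^ s = x)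
    (hG : ∀ δ : K, fourierSum χ (fun x => χ (x ^ m)) δ ^ 2 = (Fintype.card K : ℤ) * (1 - χ δ))
    (hV : ∀ a : K, fourierSum χ (fun x => χ (x ^ s)) a ^ 2 =
      (Fintype.card K : ℤ) * (1 - χ (a ^ m)))
    {q : ℕ} (hq : Fintype.card K = q) (hq8 : 8 ∣ q) (B : Set K)
    (hB : B = {y : K | ∃ x : K, y = (x + 1) ^ s + x ^ s}) :
    ((∀ S : Set K, (∃ a b : K, a ≠ 0 ∧ S = (fun x => a * x + b) '' B) → S.ncard = q / 2) ∧
      ∀ u v w : K, u ≠ v → u ≠ w → v ≠ w →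
        Nat.card {S : Set K //
          (∃ a b : K, a ≠ 0 ∧ S = (fun x => a * x + b) '' B) ∧ u ∈ S ∧ v ∈ S ∧ w ∈ S}
          = q * (q - 4) / 8) ↔
    (∃ c : ℕ, ∀ u : K, u ≠ 0 → u ≠ 1 →
      Nat.card {x : K // (u ^ d * x + (1 + u) ^ d) ^ m + x ^ m + 1 = 0} = c) := by
  classical
  have hqpos : 0 < q := hq ▸ Fintype.card_pos
  have hq0 : (q : ℤ) ≠ 0 := by exact_mod_cast hqpos.ne'
  obtain ⟨r, hr⟩ := hq8
  obtain ⟨F, hFdef⟩ : ∃ F : K → ℤ, F = derivSign s := ⟨_, rfl⟩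
  have hF : ∀ γ, fourierSum χ F γ = fourierSum χ (fun x => χ (x ^ m)) (γ ^ d) := by
    rw [hFdef]
    exact fourierSum_derivSign h1 hd0 hds (sum_addChar_pow_mul_shift h1 hV)
  have hFB : ∀ x, F x = if x ∈ B then -1 else 1 := by
    intro x
    have := derivSign_eq h1 hd (by rwa [hFdef] at hF) x
    rw [hFdef]
    split_ifs with h
    · rw [hB] at h
      exact this.1 h
    · rw [hB] at h
      exact this.2 h
  have hF2 : ∀ x, F x * F x = 1 := by
    intro x
    rw [hFB]
    split_ifs <;> norm_num
  have h0 : ∑ x, F x = 0 := by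
    have := hF 0
    simp only [fourierSum, zero_mul, zero_pow hd0, AddChar.map_zero_eq_one, mul_one] at this
    rw [this, hm.sum_comp fun x => χ x, sum_addChar h1]
  have hinj : ∀ {a b a' b' : K}, a ≠ 0 → a' ≠ 0 →
      (fun x => a * x + b) '' B = (fun x => a' * x + b') '' B → a = a' ∧ b = b' := by
    intro a b a' b' ha ha' h
    refine affine_eq_of_comp_eq h1 hd0 hd hF hG ha ha' fun x => ?_
    rw [hFB, hFB]
    simp only [← mem_image_affine ha, ← mem_image_affine ha', h]
  have hBcard : B.ncard = q / 2 := by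
    have e : ∀ x, F x = 1 - 2 * if x ∈ B then 1 else 0 := by
      intro x
      rw [hFB]
      split_ifs <;> norm_num
    rw [sum_congr rfl fun x _ => e x, sum_sub_distrib, ← mul_sum, sum_boole] at h0
    simp only [sum_const, card_univ, hq, nsmul_eq_mul, mul_one] at h0
    rw [Set.ncard_eq_toFinset_card', Set.toFinset_card, Fintype.card_subtype]
    omega
  have hcount : ∀ t : K, t ≠ 0 → t ≠ 1 →
      8 * (Nat.card {p : K × K //
        p.1 ∈ B ∧ p.2 ∈ B ∧ (t + 1) * p.1 + t * p.2 ∈ B ∧ p.1 ≠ p.2} : ℤ) =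
      (q : ℤ) ^ 2 - 4 * q -
        q * (Nat.card {x : K // (t ^ d * x + (1 + t) ^ d) ^ m + x ^ m + 1 = 0} - 1) := by
    intro t ht0 ht1
    rw [eight_mul_card_triples hFB h0 ht0 ht1, sum_sum_sign h1 hd hm0 hm hF ht1, hq,
      Nat.card_eq_fintype_card, Fintype.card_subtype]
  have hval : ∀ t : K, t ≠ 0 → t ≠ 1 → (Nat.card {p : K × K //
        p.1 ∈ B ∧ p.2 ∈ B ∧ (t + 1) * p.1 + t * p.2 ∈ B ∧ p.1 ≠ p.2} = q * (q - 4) / 8 ↔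
      Nat.card {x : K // (t ^ d * x + (1 + t) ^ d) ^ m + x ^ m + 1 = 0} = 1) := by
    intro t ht0 ht1
    have h := hcount t ht0 ht1
    have e : ((q * (q - 4) / 8 : ℕ) : ℤ) * 8 = (q : ℤ) ^ 2 - 4 * q := by
      have h8 : q * (q - 4) / 8 * 8 = q * (q - 4) :=
        Nat.div_mul_cancel (Dvd.dvd.mul_right ⟨r, hr⟩ _)
      have h4 : 4 ≤ q := by omega
      generalize q * (q - 4) / 8 = N at h8 ⊢
      zify [h4] at h8
      rw [h8]
      ring
    constructor
    · intro hN
      rw [hN, mul_comm, e] at h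
      have : (q : ℤ) *
          (Nat.card {x : K // (t ^ d * x + (1 + t) ^ d) ^ m + x ^ m + 1 = 0} - 1) = 0 := by
        linarith
      have := (mul_eq_zero.mp this).resolve_left hq0
      omega
    · intro hM
      rw [hM] at h
      push_cast at h
      have : (8 : ℤ) * (Nat.card {p : K × K //
          p.1 ∈ B ∧ p.2 ∈ B ∧ (t + 1) * p.1 + t * p.2 ∈ B ∧ p.1 ≠ p.2} : ℤ) =
          8 * ((q * (q - 4) / 8 : ℕ) : ℤ) := by
        rw [h, mul_comm 8, e]
        ring
      omega
  constructor
  · rintro ⟨-, hdes⟩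
    refine ⟨1, fun t ht0 ht1 => ?_⟩
    rw [← hval t ht0 ht1, ← hdes 0 1 t zero_ne_one ht0.symm ht1.symm,
      card_blocks_eq hinj zero_ne_one]
    simp
  · rintro ⟨c, hc⟩
    have hc1 : c = 1 := by
      have hS := sum_sum_sum_sign hF2 h0
      obtain ⟨hS0, hS1⟩ := sum_sum_sign_zero_and_one hF2 h0
      have hS' : ∀ t : K, ∑ x, ∑ y, F x * F y * F ((t + 1) * x + t * y) =
          if t = 0 ∨ t = 1 then 0 else (q : ℤ) * (c - 1) := by
        intro t
        split_ifs with h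
        · rcases h with rfl | rfl
          · exact hS0
          · exact hS1
        · push Not at h
          rw [sum_sum_sign h1 hd hm0 hm hF h.2, hq, ← hc t h.1 h.2, Nat.card_eq_fintype_card,
            Fintype.card_subtype]
      obtain ⟨t, ht0, ht1⟩ : ∃ t : K, t ≠ 0 ∧ t ≠ 1 := by
        by_contra! hall
        have : Fintype.card K ≤ #({0, 1} : Finset K) := by
          rw [← card_univ]
          apply card_le_card
          intro t _
          simp only [mem_insert, mem_singleton]
          by_cases h : t = 0
          · exact Or.inl h
          · exact Or.inr (hall t h)
        have h2 : #({0, 1} : Finset K) ≤ 2 := card_le_two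
        omega
      rw [sum_congr rfl fun t _ => hS' t, sum_ite, sum_const_zero, zero_add, sum_const,
        smul_eq_zero] at hS
      rcases hS with hS | hS
      · rw [card_eq_zero, filter_eq_empty_iff] at hS
        exact absurd (not_not.mp (hS (mem_univ t))) (by tauto)
      · have := (mul_eq_zero.mp hS).resolve_left hq0
        omega
    subst hc1
    constructor
    · rintro S ⟨a, b, ha, rfl⟩
      rw [Set.ncard_image_of_injective _ fun x y h => mul_left_cancel₀ ha (add_right_cancel h),
        hBcard]
    · intro u v w huv huw hvw
      have huv' : u + v ≠ 0 := by rwa [Ne, CharTwo.add_eq_zero]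
      rw [card_blocks_eq hinj huv, hval, hc]
      · exact div_ne_zero (by rwa [Ne, CharTwo.add_eq_zero]) huv'
      · rw [Ne, div_eq_one_iff_eq huv']
        exact fun h => hvw (add_left_cancel h).symm
      · exact div_ne_zero (by rwa [Ne, CharTwo.add_eq_zero]) huv'
      · rw [Ne, div_eq_one_iff_eq huv']
        exact fun h => hvw (add_left_cancel h).symm

end Design
section PowerMaps

variable {τ : K →+* K} (hτ : ∀ x, τ (τ (τ x)) = x ^ 2) (h3 : ∀ y : K, y ^ 3 = 1 → y = 1)
variable (h1 : χ 1 = -1) (hχ : ∀ x, χ (τ x) = χ x) (hsq : ∀ x, χ (x ^ 2) = χ x) {m s : ℕ}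

include hτ h3 h1 hχ in
theorem fourierSum_addChar_pow_sq (hxm : ∀ x, χ (x ^ m) = χ (x * τ x)) (δ : K) :
    fourierSum χ (fun x => χ (x ^ m)) δ ^ 2 = (Fintype.card K : ℤ) * (1 - χ δ) := by
  rw [← sum_addChar_mul_ringHom_sq hτ h3 h1 hχ δ, fourierSum]
  simp only [hxm, AddChar.map_add_eq_mul]

include hτ h3 h1 hχ hsq in
theorem fourierSum_addChar_inv_pow_sq (hns : ¬ IsSquare (Fintype.card K : ℤ))
    (hm : Function.Bijective fun x : K => x ^ m) (hms : ∀ y : K, χ ((y ^ m) ^ s) = χ (y ^ 3))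
    {g : K → K} (hg : ∀ a y, χ (a * y ^ m) = χ (g a * (y * τ y)))
    (hga : ∀ a, χ (g a * τ (g a)) = χ (a ^ m)) (a : K) :
    fourierSum χ (fun x => χ (x ^ s)) a ^ 2 = (Fintype.card K : ℤ) * (1 - χ (a ^ m)) := by
  rw [← hga, ← sum_addChar_cubic_sq hτ h3 h1 hχ hsq hns, fourierSum,
    ← hm.sum_comp fun x => χ (x ^ s) * χ (a * x)]
  simp only [hms, hg, AddChar.map_add_eq_mul]

end PowerMaps
end CharacterSums
section GaloisField

theorem eq_one_of_pow_three_eq_one {K : Type*} [Field K] [Fintype K] {n : ℕ}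
    (hn : Odd n) (hK : Fintype.card K = 2 ^ n) (y : K) (hy : y ^ 3 = 1) : y = 1 := by
  obtain ⟨k, rfl⟩ := hn
  have h := FiniteField.pow_card y
  have h4 : (2 : ℕ) ^ (2 * k + 1) = 3 * ((4 ^ k - 1) / 3 * 2) + 2 := by
    have h1 : 3 ∣ 4 ^ k - 1 := by simpa using Nat.sub_dvd_pow_sub_pow 4 1 k
    have h2 : 0 < 4 ^ k := by positivity
    rw [pow_succ, pow_mul]
    norm_num
    omega
  rw [hK, h4, pow_add, pow_mul, hy, one_pow, one_mul] at h
  rw [← hy, pow_succ, h, ← sq, h]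

theorem not_isSquare_two_pow {n : ℕ} (hn : Odd n) : ¬ IsSquare ((2 ^ n : ℕ) : ℤ) := by
  rintro ⟨r, hr⟩
  have h : r.natAbs * r.natAbs = 2 ^ n := by
    rw [← Int.natAbs_mul, ← hr, Int.natAbs_natCast]
  obtain ⟨j, -, hj⟩ := (Nat.dvd_prime_pow Nat.prime_two).1 (Dvd.intro _ h)
  rw [hj, ← pow_add] at h
  have := Nat.pow_right_injective le_rfl h
  rw [← this] at hn
  exact (Nat.not_odd_iff_even.2 (Even.add_self j)) hn

theorem pow_two_pow_mul_self_add {K : Type*} [Field K] [Fintype K] {n : ℕ}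
    (hK : Fintype.card K = 2 ^ n) (x : K) (k r : ℕ) : x ^ 2 ^ (n * k + r) = x ^ 2 ^ r := by
  rw [pow_add, pow_mul, pow_mul, ← hK, FiniteField.pow_card_pow]

theorem exists_addChar_galoisField {n : ℕ} (hn : Odd n) :
    ∃ χ : AddChar (GaloisField 2 n) ℤ, χ 1 = -1 ∧ ∀ x, χ (x ^ 2) = χ x := by
  have h2 : (-1 : ℤ) ^ 2 = 1 := by norm_num
  refine ⟨(AddChar.zmodChar 2 h2).compAddMonoidHom
    (Algebra.trace (ZMod 2) (GaloisField 2 n)).toAddMonoidHom, ?_, fun x => ?_⟩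
  · have h : Algebra.trace (ZMod 2) (GaloisField 2 n) 1 = 1 := by
      rw [← map_one (algebraMap (ZMod 2) (GaloisField 2 n)), Algebra.trace_algebraMap,
        GaloisField.finrank 2 hn.pos.ne']
      simpa using (ZMod.natCast_eq_one_iff_odd).2 hn
    simp [h, AddChar.zmodChar_apply]
    decide
  · have h := Algebra.trace_eq_of_algEquiv
      (FiniteField.frobeniusAlgEquiv (ZMod 2) (GaloisField 2 n) 2) x
    simp [FiniteField.frobeniusAlgEquiv] at h ⊢
    rw [h]

end GaloisField
section Kasami

theorem addChar_pow_two_pow {K : Type*} [Field K] {χ : AddChar K ℤ}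
    (hsq : ∀ x, χ (x ^ 2) = χ x) (x : K) (k : ℕ) : χ (x ^ 2 ^ k) = χ x := by
  induction k with
  | zero => simp
  | succ k ih => rw [pow_succ, pow_mul, hsq, ih]

theorem two_pow_add_one_mul_eq (i : ℕ) :
    (2 ^ i + 1) * (2 ^ (2 * i) - 2 ^ i + 1) = 2 ^ (3 * i) + 1 := by
  have h : 2 ^ i ≤ 2 ^ (2 * i) := Nat.pow_le_pow_right two_pos (by omega)
  zify [h]
  ring

variable {K : Type*} [Field K] [Fintype K] [CharP K 2] {χ : AddChar K ℤ}

theorem fourierSum_kasami_sq_of_add_one_eq {n i : ℕ} (hn : n + 1 = 3 * i) (hodd : Odd n)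
    (hK : Fintype.card K = 2 ^ n) (h1 : χ 1 = -1) (hsq : ∀ x, χ (x ^ 2) = χ x) :
    (Function.Bijective fun x : K => x ^ (2 ^ i + 1)) ∧
    (∀ δ, fourierSum χ (fun x => χ (x ^ (2 ^ i + 1))) δ ^ 2 =
      (Fintype.card K : ℤ) * (1 - χ δ)) ∧
    ∀ a, fourierSum χ (fun x => χ (x ^ (2 ^ (2 * i) - 2 ^ i + 1))) a ^ 2 =
      (Fintype.card K : ℤ) * (1 - χ (a ^ (2 ^ i + 1))) := by
  have h3 := eq_one_of_pow_three_eq_one hodd hK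
  have hns : ¬ IsSquare (Fintype.card K : ℤ) := hK ▸ not_isSquare_two_pow hodd
  have hpow : ∀ x : K, x ^ 2 ^ (3 * i) = x ^ 2 := fun x => by
    rw [← hn]
    simpa using pow_two_pow_mul_self_add hK x 1 1
  have hτ : ∀ x : K, iterateFrobenius K 2 i (iterateFrobenius K 2 i (iterateFrobenius K 2 i x)) =
      x ^ 2 := fun x => by
    simp only [iterateFrobenius_def, ← pow_mul, ← pow_add]
    rw [← hpow, ← two_mul, ← add_one_mul, two_add_one_eq_three]
  have hχ : ∀ x, χ (iterateFrobenius K 2 i x) = χ x := fun x => addChar_pow_two_pow hsq x i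
  have hxm : ∀ x : K, x ^ (2 ^ i + 1) = x * iterateFrobenius K 2 i x := fun x => by
    rw [pow_succ', iterateFrobenius_def]
  have hm : Function.Bijective fun x : K => x ^ (2 ^ i + 1) := by
    simpa only [hxm] using bijective_mul_ringHom hτ h3
  refine ⟨hm, fourierSum_addChar_pow_sq hτ h3 h1 hχ fun x => by rw [hxm],
    fourierSum_addChar_inv_pow_sq hτ h3 h1 hχ hsq hns hm (fun y => ?_) (g := id)
      (fun a y => by rw [hxm, id]) fun a => by rw [hxm, id]⟩
  rw [← pow_mul, two_pow_add_one_mul_eq, pow_succ, hpow, ← pow_succ]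

theorem fourierSum_kasami_sq_of_eq_add_one {n i : ℕ} (hn : n = 3 * i + 1) (hodd : Odd n)
    (hK : Fintype.card K = 2 ^ n) (h1 : χ 1 = -1) (hsq : ∀ x, χ (x ^ 2) = χ x) :
    (Function.Bijective fun x : K => x ^ (2 ^ i + 1)) ∧
    (∀ δ, fourierSum χ (fun x => χ (x ^ (2 ^ i + 1))) δ ^ 2 =
      (Fintype.card K : ℤ) * (1 - χ δ)) ∧
    ∀ a, fourierSum χ (fun x => χ (x ^ (2 ^ (2 * i) - 2 ^ i + 1))) a ^ 2 =
      (Fintype.card K : ℤ) * (1 - χ (a ^ (2 ^ i + 1))) := by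
  have h3 := eq_one_of_pow_three_eq_one hodd hK
  have hns : ¬ IsSquare (Fintype.card K : ℤ) := hK ▸ not_isSquare_two_pow hodd
  set τ := iterateFrobenius K 2 (2 * i + 1) with hτdef
  have hτ : ∀ x : K, τ (τ (τ x)) = x ^ 2 := fun x => by
    simp only [hτdef, iterateFrobenius_def, ← pow_mul, ← pow_add]
    have h : 2 * i + 1 + (2 * i + 1) + (2 * i + 1) = n * 2 + 1 := by omega
    rw [h, pow_two_pow_mul_self_add hK, pow_one]
  have hχ : ∀ x, χ (τ x) = χ x := fun x => addChar_pow_two_pow hsq x _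
  have hτi : ∀ x : K, τ x ^ 2 ^ i = x := fun x => by
    rw [hτdef, iterateFrobenius_def, ← pow_mul, ← pow_add]
    have h : 2 * i + 1 + i = n * 1 + 0 := by omega
    rw [h, pow_two_pow_mul_self_add hK, pow_zero, pow_one]
  have hτm : ∀ x : K, τ (x ^ (2 ^ i + 1)) = x * τ x := fun x => by
    rw [map_pow, pow_succ, hτi]
  have hxm : ∀ x, χ (x ^ (2 ^ i + 1)) = χ (x * τ x) := fun x => by rw [← hτm, hχ]
  have hm : Function.Bijective fun x : K => x ^ (2 ^ i + 1) := by
    refine Finite.injective_iff_bijective.1 fun x y hxy =>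
      (bijective_mul_ringHom hτ h3).injective ?_
    simpa only [hτm] using congrArg τ hxy
  refine ⟨hm, fourierSum_addChar_pow_sq hτ h3 h1 hχ hxm,
    fourierSum_addChar_inv_pow_sq hτ h3 h1 hχ hsq hns hm (fun y => ?_) (g := τ)
      (fun a y => by rw [← hχ, map_mul, hτm]) fun a => by rw [← map_mul, hχ, hxm]⟩
  rw [← hsq, ← pow_mul, ← pow_mul, ← mul_assoc, two_pow_add_one_mul_eq, add_mul, ← pow_succ, ← hn,
    one_mul, pow_add, ← hK, FiniteField.pow_card, ← pow_succ']

end Kasami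
/-- Proposition 4.7: for even `i`, `n = 3i ± 1`, `s = 2^{2i} - 2^i + 1` and
`d = 1/s mod 2^n - 1`, the orbit of `B_s = {(x+1)^s + x^s}` is a `3-(q, q/2, q(q-4)/8)` design
iff the number of solutions of `(u^d x + (1+u)^d)^{2^i+1} + x^{2^i+1} + 1 = 0` is independent
of `u ∈ GF(q) ∖ GF(2)`. -/
theorem stmt_16 (n i s d : ℕ) (hi : 0 < i) (hie : Even i)
    (hn : n = 3 * i + 1 ∨ n = 3 * i - 1)
    (hs : s = 2 ^ (2 * i) - 2 ^ i + 1) (hd0 : 0 < d) (hd : s * d ≡ 1 [MOD 2 ^ n - 1])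
    (B : Set (GaloisField 2 n))
    (hB : B = {y : GaloisField 2 n | ∃ x : GaloisField 2 n, y = (x + 1) ^ s + x ^ s}) :
    ((∀ S ∈ affOrbit B, S.ncard = 2 ^ n / 2) ∧
      ∀ u v w : GaloisField 2 n, u ≠ v → u ≠ w → v ≠ w →
        Nat.card {S : Set (GaloisField 2 n) // S ∈ affOrbit B ∧ u ∈ S ∧ v ∈ S ∧ w ∈ S}
          = 2 ^ n * (2 ^ n - 4) / 8) ↔
    (∃ c : ℕ, ∀ u : GaloisField 2 n, u ≠ 0 → u ≠ 1 →
      Nat.card {x : GaloisField 2 n //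
        (u ^ d * x + (1 + u) ^ d) ^ (2 ^ i + 1) + x ^ (2 ^ i + 1) + 1 = 0} = c) := by
  have hodd : Odd n := by
    obtain ⟨k, rfl⟩ := hie
    rcases hn with rfl | rfl
    · exact ⟨3 * k, by ring⟩
    · exact ⟨3 * k - 1, by omega⟩
  have hn3 : 3 ≤ n := by
    obtain ⟨k, rfl⟩ := hie
    omega
  have hK : Fintype.card (GaloisField 2 n) = 2 ^ n := by
    rw [← Nat.card_eq_fintype_card, GaloisField.card 2 n hodd.pos.ne']
  obtain ⟨χ, h1, hsq⟩ := exists_addChar_galoisField hodd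
  have hs0 : s ≠ 0 := by omega
  have hds : ∀ x : GaloisField 2 n, (x ^ d) ^ s = x := fun x => by
    rcases eq_or_ne x 0 with rfl | hx
    · rw [zero_pow hd0.ne', zero_pow hs0]
    · have hx1 : x ^ (2 ^ n - 1) = 1 := hK ▸ FiniteField.pow_card_sub_one_eq_one x hx
      rw [← pow_mul, mul_comm d s, pow_eq_pow_of_modEq hd hx1, pow_one]
  have hdbij : Function.Bijective fun x : GaloisField 2 n => x ^ d :=
    Finite.injective_iff_bijective.1 (Function.LeftInverse.injective hds)
  have hkasami : (Function.Bijective fun x : GaloisField 2 n => x ^ (2 ^ i + 1)) ∧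
      (∀ δ, fourierSum χ (fun x => χ (x ^ (2 ^ i + 1))) δ ^ 2 =
        (Fintype.card (GaloisField 2 n) : ℤ) * (1 - χ δ)) ∧
      ∀ a, fourierSum χ (fun x => χ (x ^ s)) a ^ 2 =
        (Fintype.card (GaloisField 2 n) : ℤ) * (1 - χ (a ^ (2 ^ i + 1))) := by
    rw [hs]
    rcases hn with hn | hn
    · exact fourierSum_kasami_sq_of_eq_add_one hn hodd hK h1 hsq
    · exact fourierSum_kasami_sq_of_add_one_eq (by omega) hodd hK h1 hsq
  obtain ⟨hm, hG, hV⟩ := hkasami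
  exact design_iff_card_const h1 (Nat.succ_ne_zero _) hd0.ne' hm hdbij hds hG hV hK
    (pow_dvd_pow 2 hn3) B hB
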